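/- arXiv:0912.1168 — 2 statements merged into one kernel-verified Lean document; each statement's English description precedes it below -/
import Mathlib

section
/- Let A be an abelian group such that both Hom(A, ℤ) and Ext¹(A, ℤ) are countable. Then A is finitely generated. Equivalently, if A is not finitely generated, then Hom(A, ℤ) or Ext¹(A, ℤ) is uncountable. -/
open CategoryTheory

/-- `Ext¹(A, B)` for abelian groups `A`, `B`, computed in the category of
`ℤ`-modules (equivalently, of abelian groups). -/
noncomputable abbrev Ext1 (A B : Type) [AddCommGroup A] [AddCommGroup B] : Type :=
  ((Ext ℤ (ModuleCat ℤ) 1).obj (Opposite.op (ModuleCat.of ℤ A))).obj (ModuleCat.of ℤ B)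

/-- The class in `Ext¹(A, B)` of a `1`-cocycle on a projective resolution of `A`: cocycles with the
same class differ by a coboundary. -/
theorem exists_cocycle_class {A : ModuleCat.{0} ℤ} (P : ProjectiveResolution A)
    (B : ModuleCat.{0} ℤ) :
    ∃ f : {c : P.complex.X 1 ⟶ B // P.complex.d 2 1 ≫ c = 0} →
      ((Ext ℤ (ModuleCat ℤ) 1).obj (Opposite.op A)).obj B,
      ∀ c c', f c = f c' → ∃ h : P.complex.X 0 ⟶ B, c.1 - c'.1 = P.complex.d 1 0 ≫ h := by
  let K := P.complex.linearYonedaObj ℤ B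
  let S := K.sc' 0 1 2
  let e : ((Ext ℤ (ModuleCat ℤ) 1).obj (Opposite.op A)).obj B ≅ S.moduleCatLeftHomologyData.H :=
    P.isoExt 1 B ≪≫ ShortComplex.homologyMapIso (K.isoSc' 0 1 2 (by simp) (by simp)) ≪≫
      S.moduleCatHomologyIso
  refine ⟨fun c => e.toLinearEquiv.symm
    ((LinearMap.range S.moduleCatToCycles).mkQ ⟨c.1, c.2⟩), fun c c' hcc => ?_⟩
  have h2 := e.toLinearEquiv.symm.injective hcc
  obtain ⟨h, hh⟩ := (Submodule.Quotient.eq _).1 h2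
  exact ⟨h, (congrArg Subtype.val hh).symm⟩

/-- The connecting map `Hom(A, ℚ/ℤ) → Ext¹(A, ℤ)`: characters with the same image differ by a
character that lifts to `ℚ`. -/
theorem exists_connecting_map (A : Type) [AddCommGroup A] :
    ∃ f : CharacterModule A → Ext1 A ℤ,
      ∀ χ χ', f χ = f χ' → ∃ φ : A →+ ℚ, ∀ a, (φ a : AddCircle (1 : ℚ)) = χ a - χ' a := by
  obtain ⟨P⟩ := HasProjectiveResolution.out (Z := ModuleCat.of ℤ A)
  obtain ⟨f, hf⟩ := exists_cocycle_class P (ModuleCat.of ℤ ℤ)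
  let ε : P.complex.X 0 ⟶ ModuleCat.of ℤ A := P.π.f 0
  have hεs : Function.Surjective ε :=
    (ModuleCat.epi_iff_surjective _).1 (inferInstanceAs (Epi (P.π.f 0)))
  have hdε : ∀ x, ε (P.complex.d 1 0 x) = 0 := fun x => by
    have := P.complex_d_comp_π_f_zero
    exact ConcreteCategory.congr_hom this x
  have hdd : ∀ x, P.complex.d 1 0 (P.complex.d 2 1 x) = 0 := fun x => by
    have := P.complex.d_comp_d 2 1 0
    exact ConcreteCategory.congr_hom this x
  have hex : ∀ x, ε x = 0 → ∃ y, P.complex.d 1 0 y = x :=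
    (ShortComplex.moduleCat_exact_iff _).1 P.exact₀
  have key : ∀ χ : CharacterModule A,
      ∃ (g : P.complex.X 0 →+ ℚ) (c : P.complex.X 1 ⟶ ModuleCat.of ℤ ℤ),
        (∀ x, (g x : AddCircle (1 : ℚ)) = χ (ε x)) ∧
        ∀ x, ((c x : ℤ) : ℚ) = g (P.complex.d 1 0 x) := by
    intro χ
    let q : ModuleCat.of ℤ ℚ ⟶ ModuleCat.of ℤ (AddCircle (1 : ℚ)) :=
      ModuleCat.ofHom (QuotientAddGroup.mk' (AddSubgroup.zmultiples (1 : ℚ))).toIntLinearMap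
    have : Epi q := (ModuleCat.epi_iff_surjective _).2 (QuotientAddGroup.mk'_surjective _)
    let χ' : A →+ AddCircle (1 : ℚ) := χ
    let g := Projective.factorThru (ε ≫ ModuleCat.ofHom χ'.toIntLinearMap) q
    have hg : ∀ x, (g x : AddCircle (1 : ℚ)) = χ (ε x) := fun x => by
      have := Projective.factorThru_comp (ε ≫ ModuleCat.ofHom χ'.toIntLinearMap) q
      exact ConcreteCategory.congr_hom this x
    have hc : ∀ x, ∃ n : ℤ, (n : ℚ) = g (P.complex.d 1 0 x) := fun x => by
      have := hg (P.complex.d 1 0 x)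
      rw [hdε, map_zero, AddCircle.coe_eq_zero_iff] at this
      simpa using this
    choose c hc using hc
    have hadd (x y) : c (x + y) = c x + c y := by
      have : (c (x + y) : ℚ) = c x + c y := by
        rw [hc, hc, hc, map_add, map_add]
      exact_mod_cast this
    exact ⟨g.hom.toAddMonoidHom, ModuleCat.ofHom ⟨⟨c, hadd⟩, fun n x => by
      simpa using map_intCast_smul (AddMonoidHom.mk' c hadd) ℤ ℤ n x⟩, hg, hc⟩
  choose g c hg hc using key
  refine ⟨fun χ => f ⟨c χ, ?_⟩, fun χ χ' h => ?_⟩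
  · ext x
    have : ((c χ (P.complex.d 2 1 x) : ℤ) : ℚ) = 0 := by rw [hc, hdd, map_zero]
    exact_mod_cast this
  · obtain ⟨h, hh⟩ := hf _ _ h
    have hh' : ∀ x, (c χ x - c χ' x : ℤ) = h (P.complex.d 1 0 x) := fun x => ConcreteCategory.congr_hom hh x
    let ψ : P.complex.X 0 →+ ℚ := g χ - g χ' - (Int.castAddHom ℚ).comp h.hom.toAddMonoidHom
    have hψ : ε.hom.toAddMonoidHom.ker ≤ ψ.ker := by
      intro x hx
      obtain ⟨y, rfl⟩ := hex x hx
      change g χ _ - g χ' _ - ((h _ : ℤ) : ℚ) = 0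
      rw [← hc, ← hc, ← hh']
      push_cast
      ring
    refine ⟨AddMonoidHom.liftOfSurjective ε.hom.toAddMonoidHom hεs ⟨ψ, hψ⟩, fun a => ?_⟩
    obtain ⟨x, rfl⟩ := hεs a
    have : AddMonoidHom.liftOfSurjective ε.hom.toAddMonoidHom hεs ⟨ψ, hψ⟩ (ε x) = ψ x :=
      AddMonoidHom.liftOfRightInverse_comp_apply _ _ _ ⟨ψ, hψ⟩ x
    rw [this, ← hg, ← hg, ← AddCircle.coe_sub, ← sub_eq_zero, ← AddCircle.coe_sub,
      AddCircle.coe_eq_zero_iff]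
    refine ⟨-h x, ?_⟩
    change _ = g χ x - g χ' x - ((h x : ℤ) : ℚ) - _
    simp

/-- A torsion group with countably many characters is finite, by the Baire category theorem applied
to its compact character group. -/
theorem finite_of_countable_characterModule {T : Type} [AddCommGroup T]
    (ht : IsAddTorsion T) (hc : Countable (CharacterModule T)) : Finite T := by
  let K : Set (T → AddCircle (1 : ℚ)) := Set.range fun (χ : T →+ AddCircle (1 : ℚ)) => χ
  have hcl : IsClosed K := AddMonoidHom.isClosed_range_coe T (AddCircle (1 : ℚ))
  have hcomp : IsCompact K := by
    refine (isCompact_univ_pi (s := fun t : T => {u : AddCircle (1 : ℚ) | addOrderOf t • u = 0})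
      fun t => (AddCircle.finite_torsion 1 (ht t).addOrderOf_pos).isCompact).of_isClosed_subset
        hcl ?_
    rintro _ ⟨χ, rfl⟩ t -
    change addOrderOf t • χ t = 0
    rw [← map_nsmul, addOrderOf_nsmul_eq_zero, map_zero]
  have : CompactSpace K := isCompact_iff_compactSpace.1 hcomp
  have : Nonempty K := ⟨⟨_, 0, rfl⟩⟩
  have : Countable K := by
    have : Countable (T →+ AddCircle (1 : ℚ)) := hc
    exact (Set.countable_range _).to_subtype
  obtain ⟨k, x, hx⟩ := nonempty_interior_of_iUnion_of_closed (f := fun k : K => ({k} : Set K))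
    (fun k => isClosed_singleton) (Set.iUnion_of_singleton K)
  obtain rfl : x = k := Set.mem_singleton_iff.1 (interior_subset hx)
  obtain ⟨_, χ, rfl⟩ := x
  obtain ⟨u, hu, hux⟩ := mem_nhds_subtype _ _ _ |>.1 (mem_interior_iff_mem_nhds.1 hx)
  rw [nhds_pi] at hu
  obtain ⟨I, hI, t, ht', htu⟩ := Filter.mem_pi.1 hu
  have hzero (ψ : T →+ AddCircle (1 : ℚ)) (hψ : ∀ i ∈ I, ψ i = 0) : ψ = 0 := by
    have hmem : (χ + ψ : T →+ AddCircle (1 : ℚ)) ∈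
        ({χ} : Set (T →+ AddCircle (1 : ℚ))) := by
      have := @hux ⟨_, χ + ψ, rfl⟩ (htu fun i hi => by
        simpa [hψ i hi] using mem_of_mem_nhds (ht' i))
      exact DFunLike.coe_injective (congrArg Subtype.val this)
    simpa using hmem
  have htop : AddSubgroup.closure I = ⊤ := by
    refine (AddSubgroup.eq_top_iff' _).2 fun a => ?_
    rw [← QuotientAddGroup.eq_zero_iff]
    refine CharacterModule.eq_zero_of_character_apply fun c => ?_
    let c' : (T ⧸ AddSubgroup.closure I) →+ AddCircle (1 : ℚ) := c
    refine DFunLike.congr_fun (hzero (c'.comp (QuotientAddGroup.mk' _)) fun i hi => ?_) a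
    have : ((i : T) : T ⧸ AddSubgroup.closure I) = 0 :=
      (QuotientAddGroup.eq_zero_iff i).2 (AddSubgroup.subset_closure hi)
    simp [this]
  have : AddGroup.FG T := AddGroup.fg_iff.2 ⟨I, htop, hI⟩
  exact AddCommGroup.finite_of_fg_isAddTorsion T ht

/-- If `Hom(F, ℤ)` and the cokernel of `Hom(A, ℚ) → Hom(A, ℚ/ℤ)` are countable, then every subgroup
of `A` that is torsion over `F` contains `F` with finite index. -/
theorem finite_quotient_of_countable {A : Type} [AddCommGroup A] {E : Type} [Countable E]
    (f : CharacterModule A → E)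
    (hf : ∀ χ χ', f χ = f χ' → ∃ φ : A →+ ℚ, ∀ a, (φ a : AddCircle (1 : ℚ)) = χ a - χ' a)
    {F B : AddSubgroup A} (hFB : F ≤ B) (hF : Countable (F →+ ℤ))
    (htor : ∀ b ∈ B, ∃ n : ℕ, n ≠ 0 ∧ n • b ∈ F) : Finite (B ⧸ F.addSubgroupOf B) := by
  have := hF
  apply finite_of_countable_characterModule
  · intro x
    obtain ⟨b, rfl⟩ := QuotientAddGroup.mk_surjective x
    obtain ⟨n, hn, hb⟩ := htor b b.2
    refine isOfFinAddOrder_iff_nsmul_eq_zero.2 ⟨n, hn.bot_lt, ?_⟩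
    rw [← QuotientAddGroup.mk_nsmul, QuotientAddGroup.eq_zero_iff]
    exact hb
  have hext (χ : CharacterModule (B ⧸ F.addSubgroupOf B)) : ∃ χ' : CharacterModule A,
      ∀ b : B, χ' b = χ (b : B ⧸ F.addSubgroupOf B) := by
    obtain ⟨χ', h⟩ := CharacterModule.dual_surjective_of_injective (R := ℤ)
      B.subtype.toIntLinearMap B.subtype_injective
      (CharacterModule.dual (QuotientAddGroup.mk' (F.addSubgroupOf B)).toIntLinearMap χ)
    exact ⟨χ', fun b => DFunLike.congr_fun h b⟩
  choose ext hext using hext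
  have hzero (χ : CharacterModule (B ⧸ F.addSubgroupOf B)) (b : B) (hb : (b : A) ∈ F) :
      ext χ b = 0 := by
    rw [hext, (QuotientAddGroup.eq_zero_iff b).2 hb, map_zero]
  refine Set.countable_univ_iff.1 ?_
  have hfib : ∀ e : E, {χ | f (ext χ) = e}.Countable := by
    intro e
    rcases Set.eq_empty_or_nonempty {χ | f (ext χ) = e} with h | ⟨χ₀, h₀⟩
    · simp [h]
    have hdiff : ∀ χ : {χ | f (ext χ) = e}, ∃ (φ : A →+ ℚ) (ψ : F →+ ℤ),
        (∀ a, (φ a : AddCircle (1 : ℚ)) = ext χ a - ext χ₀ a) ∧ ∀ a : F, (ψ a : ℚ) = φ a := by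
      rintro ⟨χ, h⟩
      obtain ⟨φ, hφ⟩ := hf (ext χ) (ext χ₀) (h.trans h₀.symm)
      have hint : ∀ a : F, ∃ n : ℤ, (n : ℚ) = φ a := by
        intro a
        have h1 := hφ a
        rw [hzero χ ⟨a, hFB a.2⟩ a.2, hzero χ₀ ⟨a, hFB a.2⟩ a.2, sub_zero,
          AddCircle.coe_eq_zero_iff] at h1
        simpa using h1
      choose ψ hψ using hint
      refine ⟨φ, AddMonoidHom.mk' ψ fun x y => ?_, hφ, hψ⟩
      have : (ψ (x + y) : ℚ) = ψ x + ψ y := by simp [hψ]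
      exact_mod_cast this
    choose φ ψ hφ hψ using hdiff
    have hinj : Function.Injective ψ := by
      intro χ χ' h
      refine Subtype.ext (DFunLike.ext _ _ fun x => ?_)
      obtain ⟨b, rfl⟩ := QuotientAddGroup.mk_surjective x
      rw [← hext, ← hext, ← sub_left_inj (a := ext χ₀ b), ← hφ, ← hφ]
      obtain ⟨n, hn, hb⟩ := htor b b.2
      have h1 : n • φ χ b = n • φ χ' b := by
        rw [← map_nsmul, ← map_nsmul, ← hψ χ ⟨_, hb⟩, ← hψ χ' ⟨_, hb⟩, h]
      rw [smul_right_injective ℚ hn h1]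
    exact hinj.countable
  convert Set.countable_iUnion hfib
  ext χ
  simp

theorem fg_of_finite_quotient {A : Type} [AddCommGroup A] {F B : AddSubgroup A} (hFB : F ≤ B)
    (hF : F.FG) [Finite (B ⧸ F.addSubgroupOf B)] : B.FG := by
  let R : Set A := Set.range fun q : B ⧸ F.addSubgroupOf B => (q.out : A)
  suffices B = F ⊔ AddSubgroup.closure R by
    rw [this]
    exact hF.sup ((AddSubgroup.fg_iff _).2 ⟨R, rfl, Set.finite_range _⟩)
  refine le_antisymm (fun b hb => ?_) (sup_le hFB ?_)
  · let q : B ⧸ F.addSubgroupOf B := ((⟨b, hb⟩ : B) : B ⧸ F.addSubgroupOf B)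
    have hq : -(q.out : A) + b ∈ F := by
      have h : ((q.out : B) : B ⧸ F.addSubgroupOf B) = ((⟨b, hb⟩ : B) : B ⧸ F.addSubgroupOf B) :=
        Quotient.out_eq q
      have h' := QuotientAddGroup.eq.1 h
      exact h'
    rw [show b = (-(q.out : A) + b) + q.out by abel]
    exact AddSubgroup.add_mem_sup hq (AddSubgroup.subset_closure ⟨q, rfl⟩)
  · rw [AddSubgroup.closure_le]
    rintro _ ⟨q, rfl⟩
    exact q.out.2

theorem countable_hom_int_of_fg (F : Type) [AddCommGroup F] (hF : AddGroup.FG F) :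
    Countable (F →+ ℤ) := by
  obtain ⟨S, hS, hfin⟩ := AddGroup.fg_iff.1 hF
  have := hfin.to_subtype
  exact Function.Injective.countable (f := fun (φ : F →+ ℤ) (s : S) => φ s) fun φ ψ h =>
    AddMonoidHom.eq_of_eqOn_dense hS fun s hs => congrFun h ⟨s, hs⟩

/-- If `A / 2A` is finite and every subgroup torsion over a finitely generated one is finitely
generated, then `A` is finitely generated. -/
theorem fg_of_torsion_over {A : Type} [AddCommGroup A]
    (h2 : Finite (A ⧸ (nsmulAddMonoidHom 2 : A →+ A).range))
    (h : ∀ F B : AddSubgroup A, F ≤ B → F.FG → (∀ b ∈ B, ∃ n : ℕ, n ≠ 0 ∧ n • b ∈ F) → B.FG) :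
    AddGroup.FG A := by
  let hull (F : AddSubgroup A) : AddSubgroup A :=
    { carrier := {a | ∃ n : ℕ, n ≠ 0 ∧ n • a ∈ F}
      zero_mem' := ⟨1, one_ne_zero, by simp⟩
      add_mem' := by
        rintro a b ⟨m, hm, ha⟩ ⟨n, hn, hb⟩
        refine ⟨m * n, mul_ne_zero hm hn, ?_⟩
        rw [smul_add, mul_comm, mul_smul, mul_comm, mul_smul]
        exact add_mem (F.nsmul_mem ha n) (F.nsmul_mem hb m)
      neg_mem' := by
        rintro a ⟨n, hn, ha⟩
        exact ⟨n, hn, by simpa using ha⟩ }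
  have hle (F) : F ≤ hull F := fun a ha => ⟨1, one_ne_zero, by simpa using ha⟩
  have hfg (F : AddSubgroup A) (hF : F.FG) : (hull F).FG := h F _ (hle F) hF fun b hb => hb
  have hpure (F : AddSubgroup A) (n : ℕ) (hn : n ≠ 0) (a : A) (ha : n • a ∈ hull F) :
      a ∈ hull F := by
    obtain ⟨m, hm, h⟩ := ha
    exact ⟨m * n, mul_ne_zero hm hn, by rwa [mul_smul]⟩
  let D : AddSubgroup A := (nsmulAddMonoidHom 2 : A →+ A).range
  let F : AddSubgroup A := AddSubgroup.closure (Set.range (Quotient.out : A ⧸ D → A))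
  have hF : F.FG := (AddSubgroup.fg_iff _).2 ⟨_, rfl, Set.finite_range _⟩
  have hgen : ∀ a, ∃ x ∈ F, ∃ y, a = x + 2 • y := fun a => by
    have hout : ((a : A ⧸ D).out : A ⧸ D) = a := Quotient.out_eq _
    obtain ⟨y, hy⟩ := QuotientAddGroup.eq.1 hout
    refine ⟨_, AddSubgroup.subset_closure ⟨(a : A ⧸ D), rfl⟩, y, ?_⟩
    rw [show 2 • y = _ from hy]
    abel
  suffices htop : hull F = ⊤ by
    rw [AddGroup.fg_def, ← htop]
    exact hfg F hF
  refine (AddSubgroup.eq_top_iff' _).2 fun a => ?_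
  let B := hull (F ⊔ AddSubgroup.zmultiples a)
  have hB : B.FG := hfg _ (hF.sup ⟨{a}, by simp [AddSubgroup.zmultiples_eq_closure]⟩)
  obtain ⟨r, hr, hrB⟩ := Submodule.exists_sub_one_mem_and_smul_le_of_fg_of_le_sup
    (I := Ideal.span {(2 : ℤ)}) (N := AddSubgroup.toIntSubmodule (hull F))
    (N' := AddSubgroup.toIntSubmodule B) (P := AddSubgroup.toIntSubmodule B)
    ((Submodule.fg_iff_addSubgroup_fg _).2 hB) le_rfl (by
      rw [Submodule.ideal_span_singleton_smul]
      intro b hb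
      obtain ⟨x, hx, y, rfl⟩ := hgen b
      have hxB : x ∈ B := hle _ (AddSubgroup.mem_sup_left hx)
      have hyB : y ∈ B := hpure _ 2 two_ne_zero y (by
        rw [← add_sub_cancel_left x (2 • y)]
        exact B.sub_mem hb hxB)
      refine Submodule.add_mem_sup (hle F hx) ?_
      exact (Submodule.mem_smul_pointwise_iff_exists _ _ _).2 ⟨y, hyB, by simp [two_smul]⟩)
  have haB : a ∈ B := hle _ (AddSubgroup.mem_sup_right (AddSubgroup.mem_zmultiples a))
  have hra : r • a ∈ hull F := hrB (Submodule.smul_mem_pointwise_smul a r _ haB)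
  have hr0 : r ≠ 0 := by
    rintro rfl
    rw [Ideal.mem_span_singleton] at hr
    omega
  refine hpure F r.natAbs (Int.natAbs_ne_zero.2 hr0) a ?_
  rw [← natCast_zsmul]
  rcases Int.natAbs_eq r with h | h
  · rwa [← h]
  · rwa [← neg_mem_iff, ← neg_smul, ← h]

/-- If `A` is an abelian group such that both `Hom(A, ℤ)` and `Ext¹(A, ℤ)` are
countable, then `A` is finitely generated. -/
theorem fg_of_countable_hom_ext (A : Type) [AddCommGroup A]
    (h1 : Countable (A →+ ℤ)) (h2 : Countable (Ext1 A ℤ)) :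
    AddGroup.FG A := by
  obtain ⟨f, hf⟩ := exists_connecting_map A
  refine fg_of_torsion_over ?_ fun F B hFB hF htor => ?_
  · have hF : Countable ((nsmulAddMonoidHom 2 : A →+ A).range →+ ℤ) :=
      Function.Injective.countable
        (f := fun φ => φ.comp (nsmulAddMonoidHom 2 : A →+ A).rangeRestrict) fun φ ψ h =>
          (AddMonoidHom.cancel_right (AddMonoidHom.rangeRestrict_surjective _)).1 h
    have := finite_quotient_of_countable f hf le_top hF fun b _ => ⟨2, two_ne_zero, b, rfl⟩
    rw [← AddSubgroup.index_ne_zero_iff_finite] at this ⊢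
    rwa [← AddSubgroup.relIndex_top_right]
  · have := finite_quotient_of_countable f hf hFB
      (countable_hom_int_of_fg F ((AddGroup.fg_iff_addSubgroup_fg F).2 hF)) htor
    exact fg_of_finite_quotient hFB hF
end

section
/- Let l be a prime and A an abelian group such that A/lA is finite. Then Hom(A, ℤ) is a finitely generated free abelian group. -/
/-- If every element of `A` is congruent modulo `l • A` to a zero of `f : A →+ ℤ`, with `2 ≤ l`,
then `f = 0`. -/
lemma AddMonoidHom.eq_zero_of_forall_exists_add_zsmul {A : Type*} [AddCommGroup A] {l : ℕ}
    (hl : 2 ≤ l) (f : A →+ ℤ) (h : ∀ a, ∃ r b, a = r + (l : ℤ) • b ∧ f r = 0) : f = 0 := by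
  have key : ∀ n : ℕ, ∀ a, (l : ℤ) ^ n ∣ f a := by
    intro n
    induction n with
    | zero => simp
    | succ n ih =>
      intro a
      obtain ⟨r, b, rfl, hr⟩ := h a
      rw [map_add, hr, zero_add, map_zsmul, smul_eq_mul, pow_succ']
      exact mul_dvd_mul_left _ (ih b)
  ext a
  refine Int.eq_zero_of_dvd_of_natAbs_lt_natAbs (key (f a).natAbs a) ?_
  rw [Int.natAbs_pow, Int.natAbs_natCast]
  exact Nat.lt_pow_self hl

/-- Let `l` be a prime and `A` an abelian group such that `A/lA` is finite.
Then `Hom(A, ℤ)` is a finitely generated free abelian group. -/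
theorem hom_free_and_fg_of_finite_mod_l (l : ℕ) (hl : l.Prime)
    (A : Type) [AddCommGroup A]
    (hfin : Finite (A ⧸ (zsmulAddGroupHom (l : ℤ) : A →+ A).range)) :
    Module.Free ℤ (A →+ ℤ) ∧ Module.Finite ℤ (A →+ ℤ) := by
  let ev : (A →+ ℤ) →ₗ[ℤ] (A ⧸ (zsmulAddGroupHom (l : ℤ) : A →+ A).range) → ℤ :=
    { toFun := fun f q ↦ f q.out
      map_add' := fun _ _ ↦ rfl
      map_smul' := fun _ _ ↦ rfl }
  have hev : Function.Injective ev := by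
    rw [injective_iff_map_eq_zero]
    intro f hf
    refine f.eq_zero_of_forall_exists_add_zsmul hl.two_le fun a ↦ ?_
    obtain ⟨b, hb⟩ : -(a : A ⧸ (zsmulAddGroupHom (l : ℤ) : A →+ A).range).out + a ∈
        (zsmulAddGroupHom (l : ℤ) : A →+ A).range :=
      QuotientAddGroup.eq.mp (QuotientAddGroup.out_eq' _)
    refine ⟨_, b, ?_, congrFun hf a⟩
    rw [← zsmulAddGroupHom_apply, hb, add_neg_cancel_left]
  have : Module.Finite ℤ (A →+ ℤ) := Module.Finite.of_injective ev hev
  have : Module.IsTorsionFree ℤ (A →+ ℤ) := hev.moduleIsTorsionFree ev (map_smul ev)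
  exact ⟨inferInstance, inferInstance⟩
end
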